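/- Let n ≥ 5 and let G be a bicyclic graph with n vertices. Then χ(G) ≥ 1/√(n+2) + (n−4)/√n + 2/√(n+1) + 2/√5, with equality if and only if G is isomorphic to B_n(n−1,3). -/

import Mathlib

open SimpleGraph

/-- The degree of a vertex (stated via `Set.ncard`, so no decidability assumptions). -/
noncomputable def degR {V : Type*} (G : SimpleGraph V) (v : V) : ℕ :=
  (G.neighborSet v).ncard

/-- The sum-connectivity index `χ(G) = ∑_{uv ∈ E(G)} 1/√(d_G(u)+d_G(v))`. -/
noncomputable def sumConn {V : Type*} [Fintype V] (G : SimpleGraph V) : ℝ :=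
  ∑ e ∈ G.edgeSet.toFinite.toFinset,
    Sym2.lift ⟨fun u v => (1 : ℝ) / Real.sqrt ((degR G u : ℝ) + (degR G v : ℝ)),
      fun u v => by simp [add_comm]⟩ e

/-- Vertex type of the graph `B_n(a,b)`. -/
def BabVert (a b : ℕ) : Type := Fin 4 ⊕ Fin (a - 3) ⊕ Fin (b - 3)

instance (a b : ℕ) : Fintype (BabVert a b) := by unfold BabVert; infer_instance

def BabRel (a b : ℕ) : BabVert a b → BabVert a b → Prop
  | Sum.inl i, Sum.inl j =>
      (i = 0 ∧ j = 1) ∨ (i = 0 ∧ j = 2) ∨ (i = 0 ∧ j = 3) ∨ (i = 1 ∧ j = 2) ∨ (i = 1 ∧ j = 3)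
  | Sum.inl i, Sum.inr (Sum.inl _) => i = 0
  | Sum.inl i, Sum.inr (Sum.inr _) => i = 1
  | _, _ => False

/-- The graph `B_n(a,b)` (where `a + b = n + 2`): the unique 4-vertex bicyclic graph
(`K₄` minus the edge between vertices `2` and `3`), with `a - 3` pendent vertices
attached to the degree-three vertex `0` and `b - 3` pendent vertices attached to
the degree-three vertex `1`. -/
def BabGraph (a b : ℕ) : SimpleGraph (BabVert a b) := SimpleGraph.fromRel (BabRel a b)

/-- The minimum of the sum-connectivity index over bicyclic graphs with `n` vertices. -/
noncomputable def minSumConn (n : ℕ) : ℝ :=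
  1 / Real.sqrt ((n : ℝ) + 2) + ((n : ℝ) - 4) / Real.sqrt (n : ℝ) +
    2 / Real.sqrt ((n : ℝ) + 1) + 2 / Real.sqrt 5

lemma one_div_sqrt_lt {x r : ℝ} (hr : 0 < r) (hx : 0 < x) (h : 1 < r ^ 2 * x) :
    1 / √x < r := by
  rw [div_lt_iff₀ (Real.sqrt_pos.2 hx)]
  have := Real.sq_sqrt hx.le
  nlinarith [mul_pos hr (Real.sqrt_pos.2 hx)]

lemma lt_one_div_sqrt {x r : ℝ} (hx : 0 < x) (h : r ^ 2 * x < 1) :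
    r < 1 / √x := by
  rw [lt_div_iff₀ (Real.sqrt_pos.2 hx)]
  have := Real.sq_sqrt hx.le
  nlinarith

lemma div_sqrt_eq_mul (a x : ℝ) : a / √x = a * (1 / √x) := by ring

lemma two_div_sqrt_five_lt : 2 / √(5 : ℝ) < 0.8945 := by
  have := one_div_sqrt_lt (x := 5) (r := 0.44725) (by norm_num) (by norm_num) (by norm_num)
  rw [div_sqrt_eq_mul]
  linarith

/-- Jensen's inequality for `x ↦ 1 / √x`, with an upper bound `p` on the mean. -/
lemma card_div_sqrt_le_sum {ι : Type*} (s : Finset ι) (x : ι → ℝ) {p : ℝ} (hp : 0 < p)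
    (hx : ∀ i ∈ s, 0 < x i) (h : ∑ i ∈ s, x i ≤ p * s.card) :
    s.card / √p ≤ ∑ i ∈ s, 1 / √(x i) := by
  have tangent : ∀ i ∈ s, (3 * p - x i) / (2 * (p * √p)) ≤ 1 / √(x i) := by
    intro i hi
    have h1 := Real.sqrt_pos.2 hp
    have h2 := Real.sqrt_pos.2 (hx i hi)
    rw [div_le_div_iff₀ (by positivity) h2]
    obtain ⟨a, ha⟩ : ∃ a, a = √p := ⟨_, rfl⟩
    obtain ⟨b, hb⟩ : ∃ b, b = √(x i) := ⟨_, rfl⟩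
    have h3 : p = a ^ 2 := by rw [ha, Real.sq_sqrt hp.le]
    have h4 : x i = b ^ 2 := by rw [hb, Real.sq_sqrt (hx i hi).le]
    rw [← ha, ← hb, h4, h3]
    rw [← ha] at h1
    rw [← hb] at h2
    nlinarith [mul_nonneg (sq_nonneg (a - b)) (by positivity : 0 ≤ 2 * a + b)]
  refine le_trans ?_ (Finset.sum_le_sum tangent)
  have h1 := Real.sqrt_pos.2 hp
  rw [← Finset.sum_div, Finset.sum_sub_distrib, Finset.sum_const, nsmul_eq_mul,
    div_le_div_iff₀ h1 (by positivity)]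
  nlinarith

lemma minSumConn_le {n : ℕ} (hn : 1 ≤ n) :
    minSumConn n ≤ √(n : ℝ) - 1 / √(n : ℝ) + 2 / √5 := by
  have hpos : (0 : ℝ) < n := by exact_mod_cast hn
  have h0 := Real.sqrt_pos.2 hpos
  have h1 : 1 / √((n : ℝ) + 1) ≤ 1 / √(n : ℝ) :=
    one_div_le_one_div_of_le h0 (Real.sqrt_le_sqrt (by linarith))
  have h2 : 1 / √((n : ℝ) + 2) ≤ 1 / √(n : ℝ) :=
    one_div_le_one_div_of_le h0 (Real.sqrt_le_sqrt (by linarith))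
  have h3 : √(n : ℝ) = n * (1 / √(n : ℝ)) := by
    field_simp
    exact Real.sq_sqrt hpos.le
  unfold minSumConn
  rw [div_sqrt_eq_mul ((n : ℝ) - 4), div_sqrt_eq_mul 2 ((n : ℝ) + 1)]
  linarith

lemma minSumConn_lt_of_mean {n : ℕ} (hn : 10 ≤ n) :
    minSumConn n < ((n : ℝ) + 1) / √(((n : ℝ) + 7.1) / 2) := by
  refine (minSumConn_le (by omega)).trans_lt ?_
  have hn' : (10 : ℝ) ≤ n := by exact_mod_cast hn
  have h5 := two_div_sqrt_five_lt
  obtain ⟨x, hx⟩ : ∃ x, x = √(n : ℝ) := ⟨_, rfl⟩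
  have hxn : (n : ℝ) = x ^ 2 := by rw [hx, Real.sq_sqrt (by linarith)]
  have hx3 : 3.162 ≤ x := by rw [hx]; exact Real.le_sqrt_of_sq_le (by norm_num; linarith)
  rw [← hx]
  have hlt : x - 1 / x + 2 / √5 < x - 1 / x + 0.8945 := by linarith
  refine hlt.trans_le ?_
  rw [hxn, le_div_iff₀ (Real.sqrt_pos.2 (by positivity))]
  have hxe : x - 1 / x + 0.8945 = (x ^ 2 - 1 + 0.8945 * x) / x := by field_simp
  have hy : 0 ≤ x ^ 2 - 1 + 0.8945 * x := by nlinarith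
  rw [hxe, div_mul_eq_mul_div, div_le_iff₀ (by linarith)]
  refine abs_le_of_sq_le_sq' ?_ (by positivity) |>.2
  rw [mul_pow, Real.sq_sqrt (by positivity)]
  obtain ⟨t, rfl⟩ : ∃ t, x = 3.162 + t := ⟨x - 3.162, by ring⟩
  have ht : 0 ≤ t := by linarith
  have key : 0 ≤ (((3.162 + t) ^ 2 + 1) * (3.162 + t)) ^ 2 -
      ((3.162 + t) ^ 2 - 1 + 0.8945 * (3.162 + t)) ^ 2 * (((3.162 + t) ^ 2 + 7.1) / 2) := by
    ring_nf
    positivity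
  linarith

lemma minSumConn_lt_of_star {n d : ℕ} (hn : 10 ≤ n) (hd : d + 2 ≤ n) (hd' : n + 3 ≤ 2 * d) :
    minSumConn n < (d : ℝ) / √((d : ℝ) + 2) + ((n : ℝ) + 1 - d) / √((n : ℝ) + 4 - d) := by
  refine (minSumConn_le (by omega)).trans_lt ?_
  have h5 := two_div_sqrt_five_lt
  have hdn : (d : ℝ) + 2 ≤ n := by exact_mod_cast hd
  have hdn' : (n : ℝ) + 3 ≤ 2 * d := by exact_mod_cast hd'
  have hn' : (10 : ℝ) ≤ n := by exact_mod_cast hn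
  have hd7 : (7 : ℝ) ≤ d := by exact_mod_cast (by omega : 7 ≤ d)
  obtain ⟨x, hx⟩ : ∃ x, x = √(n : ℝ) := ⟨_, rfl⟩
  obtain ⟨a, ha⟩ : ∃ a, a = √((d : ℝ) + 2) := ⟨_, rfl⟩
  obtain ⟨c, hc⟩ : ∃ c, c = √((n : ℝ) + 4 - d) := ⟨_, rfl⟩
  have hxn : x ^ 2 = n := by rw [hx, Real.sq_sqrt (by linarith)]
  have had : a ^ 2 = d + 2 := by rw [ha, Real.sq_sqrt (by linarith)]
  have hcd : c ^ 2 = n + 4 - d := by rw [hc, Real.sq_sqrt (by linarith)]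
  have hx0 : 0 < x := by rw [hx]; exact Real.sqrt_pos.2 (by linarith)
  have ha0 : 0 < a := by rw [ha]; exact Real.sqrt_pos.2 (by linarith)
  have hc0 : 0 < c := by rw [hc]; exact Real.sqrt_pos.2 (by linarith)
  have hca : c ≤ a := by rw [hc, ha]; exact Real.sqrt_le_sqrt (by linarith)
  rw [← hx, ← ha, ← hc]
  have e1 : (d : ℝ) / a = a - 2 / a := by field_simp; linarith
  have e2 : ((n : ℝ) + 1 - d) / c = c - 3 / c := by field_simp; linarith
  rw [e1, e2]
  have hq : 0 ≤ c ^ 2 - 6 := by linarith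
  have hxa : x ≤ a + (c ^ 2 - 6) / (2 * a) := by
    refine abs_le_of_sq_le_sq' ?_ (by positivity) |>.2
    have : (a + (c ^ 2 - 6) / (2 * a)) ^ 2 =
        a ^ 2 + (c ^ 2 - 6) + ((c ^ 2 - 6) / (2 * a)) ^ 2 := by field_simp; ring
    nlinarith [sq_nonneg ((c ^ 2 - 6) / (2 * a))]
  have hinv : 1 / a - (c ^ 2 - 6) / (2 * a) / a ^ 2 ≤ 1 / x := by
    refine le_trans ?_ (one_div_le_one_div_of_le hx0 hxa)
    rw [le_div_iff₀ (by positivity)]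
    have : (1 / a - (c ^ 2 - 6) / (2 * a) / a ^ 2) * (a + (c ^ 2 - 6) / (2 * a)) =
        1 - ((c ^ 2 - 6) / (2 * a ^ 2)) ^ 2 := by field_simp; ring
    nlinarith [sq_nonneg ((c ^ 2 - 6) / (2 * a ^ 2))]
  suffices h : (c ^ 2 - 6) / (2 * a) + 1 / a + (c ^ 2 - 6) / (2 * a) / a ^ 2 + 0.8945 ≤
      c - 3 / c by
    have : 2 / a = 2 * (1 / a) := by ring
    linarith
  rcases Nat.lt_or_ge (d + 2) n with h | h
  · have hk : (d : ℝ) + 3 ≤ n := by exact_mod_cast h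
    have hc7 : 2.6457 ≤ c := by
      rw [hc]; exact Real.le_sqrt_of_sq_le (by norm_num; linarith)
    have b1 : (c ^ 2 - 6) / (2 * a) ≤ (c ^ 2 - 6) / (2 * c) := by gcongr
    have b2 : 1 / a ≤ 1 / c := by gcongr
    have b3 : (c ^ 2 - 6) / (2 * a) / a ^ 2 ≤ (c ^ 2 - 6) / (2 * c) / 9 := by
      gcongr
      linarith
    refine le_trans (add_le_add (add_le_add (add_le_add b1 b2) b3) le_rfl) ?_
    rw [← sub_nonneg]
    have : c - 3 / c - ((c ^ 2 - 6) / (2 * c) + 1 / c + (c ^ 2 - 6) / (2 * c) / 9 + 0.8945) =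
        (4 / 9 * c ^ 2 - 0.8945 * c - 2 / 3) / c := by field_simp; ring
    rw [this]
    exact div_nonneg (by nlinarith) hc0.le
  · have hk : (d : ℝ) + 2 = n := by exact_mod_cast le_antisymm hd h
    have hd8 : (8 : ℝ) ≤ d := by exact_mod_cast (by omega : 8 ≤ d)
    have hc6 : c ^ 2 = 6 := by linarith
    have hc7 : 2.449 ≤ c := by
      rw [hc]; exact Real.le_sqrt_of_sq_le (by norm_num; linarith)
    have ha3 : 3.162 ≤ a := by
      rw [ha]; exact Real.le_sqrt_of_sq_le (by norm_num; linarith)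
    have b2 : 1 / a ≤ 1 / 3.162 := by gcongr
    have e3 : 3 / c = c / 2 := by field_simp; linarith
    rw [hc6, e3]
    norm_num at b2 ⊢
    linarith

lemma minSumConn_lt_of_disjoint {n : ℕ} (hn : 8 ≤ n) :
    minSumConn n < ((n : ℝ) - 1) / √((n : ℝ) + 4 / ((n : ℝ) - 1)) + 2 / √4 := by
  refine (minSumConn_le (by omega)).trans_lt ?_
  have h5 := two_div_sqrt_five_lt
  have hn' : (8 : ℝ) ≤ n := by exact_mod_cast hn
  obtain ⟨x, hx⟩ : ∃ x, x = √(n : ℝ) := ⟨_, rfl⟩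
  have hxn : (n : ℝ) = x ^ 2 := by rw [hx, Real.sq_sqrt (by linarith)]
  have hx3 : 2.828 ≤ x := by rw [hx]; exact Real.le_sqrt_of_sq_le (by norm_num; linarith)
  have h4 : √(4 : ℝ) = 2 := by
    rw [show (4 : ℝ) = 2 ^ 2 by norm_num]; exact Real.sqrt_sq (by norm_num)
  have hx1 : 0 < x ^ 2 - 1 := by nlinarith
  rw [← hx, hxn, h4]
  have hle : √(x ^ 2 + 4 / (x ^ 2 - 1)) ≤ x + 2 / (x * (x ^ 2 - 1)) := by
    rw [Real.sqrt_le_left (by positivity)]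
    have : (x + 2 / (x * (x ^ 2 - 1))) ^ 2 =
        x ^ 2 + 4 / (x ^ 2 - 1) + (2 / (x * (x ^ 2 - 1))) ^ 2 := by field_simp; ring
    rw [this]
    nlinarith [sq_nonneg (2 / (x * (x ^ 2 - 1)))]
  have hdiv : (x ^ 2 - 1) / (x + 2 / (x * (x ^ 2 - 1))) ≤
      (x ^ 2 - 1) / √(x ^ 2 + 4 / (x ^ 2 - 1)) := by
    gcongr
  have hlow : x - 1 / x - 2 / x ^ 3 ≤ (x ^ 2 - 1) / (x + 2 / (x * (x ^ 2 - 1))) := by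
    rw [le_div_iff₀ (by positivity)]
    have : (x - 1 / x - 2 / x ^ 3) * (x + 2 / (x * (x ^ 2 - 1))) =
        x ^ 2 - 1 - 4 / (x ^ 4 * (x ^ 2 - 1)) := by field_simp; ring
    rw [this]
    have : 0 ≤ 4 / (x ^ 4 * (x ^ 2 - 1)) := by positivity
    linarith
  have h3 : 2 / x ^ 3 ≤ 2 / 2.828 ^ 3 := by gcongr
  norm_num at h3
  norm_num at h5
  linarith

lemma minSumConn_lt_of_bounds {n : ℕ} (hn : 5 ≤ n) {a b c : ℝ} (ha : 0 < a) (hb : 0 < b)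
    (hc : 0 < c) (ha' : 1 < a ^ 2 * (n + 2)) (hb' : 1 < b ^ 2 * n) (hc' : 1 < c ^ 2 * (n + 1)) :
    minSumConn n < a + (n - 4) * b + 2 * c + 0.8945 := by
  have hn' : (5 : ℝ) ≤ n := by exact_mod_cast hn
  have h1 := one_div_sqrt_lt ha (by positivity) ha'
  have h2 := mul_lt_mul_of_pos_left (one_div_sqrt_lt hb (by positivity) hb')
    (by linarith : (0 : ℝ) < n - 4)
  have h3 := one_div_sqrt_lt hc (by positivity) hc'
  have h4 := two_div_sqrt_five_lt
  unfold minSumConn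
  rw [div_sqrt_eq_mul ((n : ℝ) - 4), div_sqrt_eq_mul 2 ((n : ℝ) + 1)]
  linarith

lemma minSumConn_five_lt : minSumConn 5 < 2.5362 := by
  have h := minSumConn_lt_of_bounds (n := 5) (a := 0.37797) (b := 0.44722) (c := 0.40825)
    (by norm_num) (by norm_num) (by norm_num) (by norm_num) (by norm_num) (by norm_num)
    (by norm_num)
  norm_num at h ⊢
  linarith

lemma minSumConn_six_lt : minSumConn 6 < 2.8205 := by
  have h := minSumConn_lt_of_bounds (n := 6) (a := 0.35356) (b := 0.40825) (c := 0.37797)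
    (by norm_num) (by norm_num) (by norm_num) (by norm_num) (by norm_num) (by norm_num)
    (by norm_num)
  norm_num at h ⊢
  linarith

lemma minSumConn_seven_lt : minSumConn 7 < 3.0689 := by
  have h := minSumConn_lt_of_bounds (n := 7) (a := 0.33334) (b := 0.37797) (c := 0.35356)
    (by norm_num) (by norm_num) (by norm_num) (by norm_num) (by norm_num) (by norm_num)
    (by norm_num)
  norm_num at h ⊢
  linarith

lemma minSumConn_eight_lt : minSumConn 8 < 3.2917 := by
  have h := minSumConn_lt_of_bounds (n := 8) (a := 0.31623) (b := 0.35356) (c := 0.33334)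
    (by norm_num) (by norm_num) (by norm_num) (by norm_num) (by norm_num) (by norm_num)
    (by norm_num)
  norm_num at h ⊢
  linarith

lemma minSumConn_nine_lt : minSumConn 9 < 3.4952 := by
  have h := minSumConn_lt_of_bounds (n := 9) (a := 0.30152) (b := 0.33334) (c := 0.31623)
    (by norm_num) (by norm_num) (by norm_num) (by norm_num) (by norm_num) (by norm_num)
    (by norm_num)
  norm_num at h ⊢
  linarith

section Degrees

open Classical

variable {V : Type*} [Fintype V] (G : SimpleGraph V)

/-- The sum of the degrees of the two end vertices of an edge. -/
noncomputable def endDegreeSum (e : Sym2 V) : ℕ :=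
  Sym2.lift ⟨fun u v => G.degree u + G.degree v, fun _ _ => add_comm _ _⟩ e

/-- The edges that avoid a vertex. -/
noncomputable def edgesAvoiding (u : V) : Finset (Sym2 V) :=
  G.edgeFinset.filter (u ∉ ·)

@[simp]
lemma endDegreeSum_mk (u v : V) : endDegreeSum G s(u, v) = G.degree u + G.degree v := rfl

lemma degR_eq_degree (v : V) : degR G v = G.degree v := by
  rw [degR, Set.ncard_eq_toFinset_card', ← SimpleGraph.card_neighborFinset_eq_degree]
  rfl

lemma sumConn_eq_sum_endDegreeSum :
    sumConn G = ∑ e ∈ G.edgeFinset, 1 / √(endDegreeSum G e : ℝ) := by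
  unfold sumConn
  refine Finset.sum_congr (by ext; simp) fun e _ => ?_
  induction e with
  | _ u v => simp [degR_eq_degree]

lemma filter_mem_edgeFinset (u : V) :
    G.edgeFinset.filter (u ∈ ·) = (G.neighborFinset u).image (fun w => s(u, w)) := by
  ext e
  induction e with
  | _ a b =>
    simp only [Finset.mem_filter, SimpleGraph.mem_edgeFinset, SimpleGraph.mem_edgeSet,
      Sym2.mem_iff, Finset.mem_image, SimpleGraph.mem_neighborFinset]
    constructor
    · rintro ⟨h, rfl | rfl⟩
      · exact ⟨b, h, rfl⟩
      · exact ⟨a, h.symm, Sym2.eq_swap⟩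
    · rintro ⟨w, h, hw⟩
      rcases Sym2.eq_iff.1 hw with ⟨rfl, rfl⟩ | ⟨rfl, rfl⟩
      · exact ⟨h, Or.inl rfl⟩
      · exact ⟨h.symm, Or.inr rfl⟩

lemma card_filter_mem_edgeFinset (u : V) :
    (G.edgeFinset.filter (u ∈ ·)).card = G.degree u := by
  rw [filter_mem_edgeFinset, Finset.card_image_of_injective _ fun _ _ h => Sym2.congr_right.1 h,
    SimpleGraph.card_neighborFinset_eq_degree]

lemma card_edgesAvoiding_add_degree (u : V) :
    (edgesAvoiding G u).card + G.degree u = G.edgeFinset.card := by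
  rw [← card_filter_mem_edgeFinset, add_comm]
  exact Finset.card_filter_add_card_filter_not _

/-- The contributions of the edges at `u` and of the edges avoiding `u`. -/
lemma sumConn_eq_sum_neighbor_add (u : V) :
    sumConn G = ∑ w ∈ G.neighborFinset u, 1 / √((G.degree u : ℝ) + G.degree w) +
      ∑ e ∈ edgesAvoiding G u, 1 / √(endDegreeSum G e : ℝ) := by
  rw [sumConn_eq_sum_endDegreeSum, ← Finset.sum_filter_add_sum_filter_not _ (u ∈ ·),
    filter_mem_edgeFinset, Finset.sum_image fun _ _ _ _ h => Sym2.congr_right.1 h]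
  simp [edgesAvoiding]

lemma degree_le_card_filter_edgesAvoiding {u v : V} (huv : u ≠ v) :
    G.degree v ≤ ((edgesAvoiding G u).filter (v ∈ ·)).card + 1 := by
  rw [← card_filter_mem_edgeFinset]
  refine (Finset.card_le_card (t := insert s(u, v) ((edgesAvoiding G u).filter (v ∈ ·))) ?_).trans
    (Finset.card_insert_le _ _)
  intro e he
  rw [Finset.mem_filter] at he
  by_cases hu : u ∈ e
  · rw [(Sym2.mem_and_mem_iff huv).1 ⟨hu, he.2⟩]
    exact Finset.mem_insert_self _ _
  · simp [edgesAvoiding, he.1, he.2, hu]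

lemma endDegreeSum_le_of_mem_edgesAvoiding {u : V} {e : Sym2 V} (he : e ∈ edgesAvoiding G u) :
    endDegreeSum G e ≤ (edgesAvoiding G u).card + 3 := by
  induction e with
  | _ v w =>
    have hvw : v ≠ w := by
      simp only [edgesAvoiding, Finset.mem_filter, SimpleGraph.mem_edgeFinset,
        SimpleGraph.mem_edgeSet] at he
      exact he.1.ne
    have hu : u ≠ v ∧ u ≠ w := by
      simpa [edgesAvoiding] using (Finset.mem_filter.1 he).2
    have h1 := degree_le_card_filter_edgesAvoiding G hu.1
    have h2 := degree_le_card_filter_edgesAvoiding G hu.2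
    have h3 := Finset.card_union_add_card_inter
      ((edgesAvoiding G u).filter (v ∈ ·)) ((edgesAvoiding G u).filter (w ∈ ·))
    have h4 : ((edgesAvoiding G u).filter (v ∈ ·) ∪ (edgesAvoiding G u).filter (w ∈ ·)).card ≤
        (edgesAvoiding G u).card :=
      Finset.card_le_card (Finset.union_subset (Finset.filter_subset _ _)
        (Finset.filter_subset _ _))
    have h5 : ((edgesAvoiding G u).filter (v ∈ ·) ∩ (edgesAvoiding G u).filter (w ∈ ·)).card ≤
        1 := by
      refine (Finset.card_le_card (t := {s(v, w)}) fun e he => ?_).trans (by simp)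
      simp only [Finset.mem_inter, Finset.mem_filter] at he
      exact Finset.mem_singleton.2 ((Sym2.mem_and_mem_iff hvw).1 ⟨he.1.2, he.2.2⟩)
    rw [endDegreeSum_mk]
    omega

lemma endDegreeSum_pos_of_mem_edgeFinset {e : Sym2 V} (he : e ∈ G.edgeFinset) :
    0 < endDegreeSum G e := by
  induction e with
  | _ v w =>
    have h : G.Adj v w := by simpa using he
    have := (G.degree_pos_iff_exists_adj v).2 ⟨w, h⟩
    rw [endDegreeSum_mk]
    omega

lemma sum_endDegreeSum :
    ∑ e ∈ G.edgeFinset, endDegreeSum G e = ∑ v, G.degree v ^ 2 := by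
  have h : ∀ e ∈ G.edgeFinset, endDegreeSum G e = ∑ v, if v ∈ e then G.degree v else 0 := by
    intro e he
    induction e with
    | _ a b =>
      have hab : a ≠ b := by
        have h : G.Adj a b := by simpa using he
        exact h.ne
      have : (Finset.univ.filter (· ∈ s(a, b))) = {a, b} := by ext; simp
      rw [← Finset.sum_filter, this, Finset.sum_pair hab, endDegreeSum_mk]
  rw [Finset.sum_congr rfl h, Finset.sum_comm]
  refine Finset.sum_congr rfl fun v _ => ?_
  rw [← Finset.sum_filter, Finset.sum_const, card_filter_mem_edgeFinset, smul_eq_mul, sq]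

end Degrees

section Bicyclic

open Classical

variable {V : Type*} [Fintype V] {G : SimpleGraph V} {n : ℕ}

lemma sum_degree_neighborFinset_le (hcard : Fintype.card V = n) (hdeg : ∀ v, 1 ≤ G.degree v)
    (hedges : G.edgeFinset.card = n + 1) (u : V) :
    ∑ w ∈ G.neighborFinset u, G.degree w ≤ n + 3 := by
  have h1 := G.sum_degrees_eq_twice_card_edges
  rw [← Finset.sum_add_sum_compl (insert u (G.neighborFinset u)),
    Finset.sum_insert (G.notMem_neighborFinset_self u)] at h1
  have h2 : (insert u (G.neighborFinset u))ᶜ.card ≤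
      ∑ w ∈ (insert u (G.neighborFinset u))ᶜ, G.degree w := by
    rw [Finset.card_eq_sum_ones]
    exact Finset.sum_le_sum fun w _ => hdeg w
  have h3 := Finset.card_add_card_compl (insert u (G.neighborFinset u))
  rw [Finset.card_insert_of_notMem (G.notMem_neighborFinset_self u),
    SimpleGraph.card_neighborFinset_eq_degree, hcard] at h3
  omega

/-- The bound on the edges at a vertex `u` given by Jensen's inequality. -/
lemma degree_div_sqrt_add_le_sumConn (hcard : Fintype.card V = n) (hdeg : ∀ v, 1 ≤ G.degree v)
    (hedges : G.edgeFinset.card = n + 1) (u : V) {p : ℝ} (hp : 0 < p)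
    (h : (G.degree u : ℝ) ^ 2 + n + 3 ≤ p * G.degree u) :
    G.degree u / √p + ∑ e ∈ edgesAvoiding G u, 1 / √(endDegreeSum G e : ℝ) ≤ sumConn G := by
  rw [sumConn_eq_sum_neighbor_add G u]
  have h1 : (∑ w ∈ G.neighborFinset u, (G.degree w : ℝ)) ≤ n + 3 := by
    exact_mod_cast sum_degree_neighborFinset_le hcard hdeg hedges u
  have h2 := card_div_sqrt_le_sum (G.neighborFinset u)
    (fun w => (G.degree u : ℝ) + G.degree w) hp
    (fun w _ => by have := hdeg w; positivity)
    (by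
      rw [Finset.sum_add_distrib, Finset.sum_const, SimpleGraph.card_neighborFinset_eq_degree,
        nsmul_eq_mul]
      linarith)
  rw [SimpleGraph.card_neighborFinset_eq_degree] at h2
  linarith

lemma div_sqrt_add_div_sqrt_le_sumConn (hcard : Fintype.card V = n)
    (hdeg : ∀ v, 1 ≤ G.degree v) (hedges : G.edgeFinset.card = n + 1) {u : V} {d : ℕ}
    (hd : G.degree u = d) {p : ℝ} (hp : 0 < p) (h : (d : ℝ) ^ 2 + n + 3 ≤ p * d) :
    d / √p + ((n : ℝ) + 1 - d) / √((n : ℝ) + 4 - d) ≤ sumConn G := by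
  subst hd
  refine le_trans ?_ (degree_div_sqrt_add_le_sumConn hcard hdeg hedges u hp h)
  have hk := card_edgesAvoiding_add_degree G u
  rw [hedges] at hk
  have hk' : ((edgesAvoiding G u).card : ℝ) = n + 1 - G.degree u := by
    rw [eq_sub_iff_add_eq]
    exact_mod_cast hk
  have h1 : ∀ e ∈ edgesAvoiding G u,
      1 / √((n : ℝ) + 4 - G.degree u) ≤ 1 / √(endDegreeSum G e : ℝ) := by
    intro e he
    have hpos := endDegreeSum_pos_of_mem_edgeFinset G (Finset.mem_filter.1 he).1
    have hle : (endDegreeSum G e : ℝ) ≤ (edgesAvoiding G u).card + 3 := by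
      exact_mod_cast endDegreeSum_le_of_mem_edgesAvoiding G he
    exact one_div_le_one_div_of_le (Real.sqrt_pos.2 (by exact_mod_cast hpos))
      (Real.sqrt_le_sqrt (by linarith))
  have h2 := Finset.sum_le_sum h1
  rw [Finset.sum_const, nsmul_eq_mul, hk', mul_one_div] at h2
  linarith

/-- The bound on all edges given by Jensen's inequality and a bound on the degrees. -/
lemma div_sqrt_le_sumConn (hcard : Fintype.card V = n) (hdeg : ∀ v, 1 ≤ G.degree v)
    (hedges : G.edgeFinset.card = n + 1) {d : ℕ} (hd : ∀ v, G.degree v ≤ d) {p : ℝ}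
    (hp : 0 < p) (h : ((n : ℝ) + 2) * d + 2 * n + 2 ≤ p * (n + 1)) :
    ((n : ℝ) + 1) / √p ≤ sumConn G := by
  rw [sumConn_eq_sum_endDegreeSum]
  have h1 := card_div_sqrt_le_sum G.edgeFinset (fun e => (endDegreeSum G e : ℝ)) hp
    (fun e he => by exact_mod_cast endDegreeSum_pos_of_mem_edgeFinset G he)
  rw [hedges] at h1
  push_cast at h1
  refine h1 (le_trans ?_ h)
  have h2 : ∑ e ∈ G.edgeFinset, (endDegreeSum G e : ℝ) = ∑ v, (G.degree v : ℝ) ^ 2 := by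
    exact_mod_cast sum_endDegreeSum G
  have h3 : ∀ v, (G.degree v : ℝ) ^ 2 ≤ ((d : ℝ) + 1) * G.degree v - d := by
    intro v
    have a1 : (1 : ℝ) ≤ G.degree v := by exact_mod_cast hdeg v
    have a2 : (G.degree v : ℝ) ≤ d := by exact_mod_cast hd v
    nlinarith [mul_nonneg (sub_nonneg.2 a1) (sub_nonneg.2 a2)]
  have h4 : ∑ v, (G.degree v : ℝ) = 2 * (n + 1) := by
    have := G.sum_degrees_eq_twice_card_edges
    rw [hedges] at this
    exact_mod_cast this
  rw [h2]
  refine (Finset.sum_le_sum fun v _ => h3 v).trans ?_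
  rw [Finset.sum_sub_distrib, ← Finset.mul_sum, h4, Finset.sum_const, Finset.card_univ, hcard,
    nsmul_eq_mul]
  linarith

end Bicyclic

section Extremal

open Classical

variable {V W : Type*} {G : SimpleGraph V} {H : SimpleGraph W}

/-- The graph has a vertex adjacent to all the others, and the edges avoiding that vertex form
a path with two edges. -/
def IsStarPlusPath (G : SimpleGraph V) : Prop :=
  ∃ u v a b : V, [u, v, a, b].Nodup ∧ ∀ x y, G.Adj x y ↔
    x ≠ y ∧ (x = u ∨ y = u ∨ (x = v ∧ (y = a ∨ y = b)) ∨ (y = v ∧ (x = a ∨ x = b)))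

lemma IsStarPlusPath.of_iso (φ : G ≃g H) (hG : IsStarPlusPath G) : IsStarPlusPath H := by
  obtain ⟨u, v, a, b, hd, h⟩ := hG
  refine ⟨φ u, φ v, φ a, φ b, hd.map φ.injective, fun x y => ?_⟩
  obtain ⟨x, rfl⟩ := φ.surjective x
  obtain ⟨y, rfl⟩ := φ.surjective y
  rw [φ.map_adj_iff, h]
  simp

lemma IsStarPlusPath.nonempty_iso [Fintype V] [Fintype W] (hG : IsStarPlusPath G)
    (hH : IsStarPlusPath H) (hcard : Fintype.card V = Fintype.card W) : Nonempty (G ≃g H) := by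
  obtain ⟨u, v, a, b, hd, h⟩ := hG
  obtain ⟨u', v', a', b', hd', h'⟩ := hH
  obtain ⟨e⟩ := Fintype.card_eq.1 hcard
  have he := hd.map e.injective
  obtain ⟨σ, hσ⟩ := (Equiv.Perm.isMultiplyPretransitive W 4).exists_smul_eq
    ⟨[e u, e v, e a, e b].get, List.nodup_iff_injective_get.1 he⟩
    ⟨[u', v', a', b'].get, List.nodup_iff_injective_get.1 hd'⟩
  have h0 : σ (e u) = u' := DFunLike.congr_fun hσ 0
  have h1 : σ (e v) = v' := DFunLike.congr_fun hσ 1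
  have h2 : σ (e a) = a' := DFunLike.congr_fun hσ 2
  have h3 : σ (e b) = b' := DFunLike.congr_fun hσ 3
  subst h0 h1 h2 h3
  refine ⟨⟨e.trans σ, fun {x y} => ?_⟩⟩
  simp [h, h']

lemma isStarPlusPath_BabGraph (a : ℕ) : IsStarPlusPath (BabGraph a 3) := by
  refine ⟨Sum.inl 0, Sum.inl 1, Sum.inl 2, Sum.inl 3, ?_, ?_⟩
  · simp [BabVert]
  · intro x y
    rw [BabGraph, SimpleGraph.fromRel_adj]
    refine and_congr_right fun hne => ?_
    rcases x with x | x | x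
    · rcases y with y | y | y
      · fin_cases x <;> fin_cases y <;> first | exact absurd rfl hne | simp [BabRel, BabVert]
      · fin_cases x <;> simp [BabRel, BabVert]
      · exact Fin.elim0 y
    · rcases y with y | y | y
      · fin_cases y <;> simp [BabRel, BabVert]
      · simp [BabRel, BabVert]
      · exact Fin.elim0 y
    · exact Fin.elim0 x

lemma IsStarPlusPath.sumConn_eq [Fintype V] {n : ℕ} (hG : IsStarPlusPath G)
    (hcard : Fintype.card V = n) : sumConn G = minSumConn n := by
  obtain ⟨u, v, a, b, hd, h⟩ := hG
  simp only [List.nodup_cons, List.mem_cons, List.not_mem_nil, or_false, not_or,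
    not_false_eq_true, List.nodup_nil, and_true] at hd
  obtain ⟨⟨huv, hua, hub⟩, ⟨hva, hvb⟩, hab⟩ := hd
  have hN : G.neighborFinset u = Finset.univ.erase u := by
    ext x
    simp only [SimpleGraph.mem_neighborFinset, h, Finset.mem_erase, Finset.mem_univ]
    grind
  have hNv : G.neighborFinset v = {u, a, b} := by
    ext x
    simp only [SimpleGraph.mem_neighborFinset, h, Finset.mem_insert, Finset.mem_singleton]
    grind
  have hNa : G.neighborFinset a = {u, v} := by
    ext x
    simp only [SimpleGraph.mem_neighborFinset, h, Finset.mem_insert, Finset.mem_singleton]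
    grind
  have hNb : G.neighborFinset b = {u, v} := by
    ext x
    simp only [SimpleGraph.mem_neighborFinset, h, Finset.mem_insert, Finset.mem_singleton]
    grind
  have hNx : ∀ x, x ∉ ({u, v, a, b} : Finset V) → G.neighborFinset x = {u} := by
    intro x hx
    simp only [Finset.mem_insert, Finset.mem_singleton, not_or] at hx
    ext y
    simp only [SimpleGraph.mem_neighborFinset, h, Finset.mem_singleton]
    grind
  have hF : edgesAvoiding G u = {s(v, a), s(v, b)} := by
    ext e
    induction e with
    | _ x y =>
      simp only [edgesAvoiding, Finset.mem_filter, SimpleGraph.mem_edgeFinset,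
        SimpleGraph.mem_edgeSet, h, Sym2.mem_iff, Finset.mem_insert, Finset.mem_singleton,
        Sym2.eq_iff]
      grind
  have hfour : ({u, v, a, b} : Finset V).card = 4 := by
    rw [Finset.card_insert_of_notMem (by simp [huv, hua, hub]),
      Finset.card_insert_of_notMem (by simp [hva, hvb]), Finset.card_pair hab]
  have hn : 4 ≤ n := by
    rw [← hcard, ← hfour]
    exact Finset.card_le_univ _
  have du : G.degree u = n - 1 := by
    rw [← SimpleGraph.card_neighborFinset_eq_degree, hN, Finset.card_erase_of_mem
      (Finset.mem_univ _), Finset.card_univ, hcard]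
  have du' : (G.degree u : ℝ) = n - 1 := by
    rw [du, Nat.cast_sub (by omega), Nat.cast_one]
  have dv : G.degree v = 3 := by
    rw [← SimpleGraph.card_neighborFinset_eq_degree, hNv, Finset.card_eq_three]
    exact ⟨u, a, b, hua, hub, hab, rfl⟩
  have da : G.degree a = 2 := by
    rw [← SimpleGraph.card_neighborFinset_eq_degree, hNa, Finset.card_pair huv]
  have db : G.degree b = 2 := by
    rw [← SimpleGraph.card_neighborFinset_eq_degree, hNb, Finset.card_pair huv]
  have dx : ∀ x ∈ ({u, v, a, b} : Finset V)ᶜ,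
      1 / √((G.degree u : ℝ) + G.degree x) = 1 / √(n : ℝ) := by
    intro x hx
    rw [du', ← SimpleGraph.card_neighborFinset_eq_degree G x, hNx x (Finset.mem_compl.1 hx),
      Finset.card_singleton]
    norm_num
  have hsplit : (Finset.univ.erase u : Finset V) =
      insert v (insert a (insert b ({u, v, a, b} : Finset V)ᶜ)) := by
    ext x
    simp only [Finset.mem_erase, Finset.mem_univ, Finset.mem_insert, Finset.mem_compl,
      Finset.mem_singleton]
    grind
  have hrest : ((({u, v, a, b} : Finset V)ᶜ.card : ℕ) : ℝ) = n - 4 := by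
    rw [Finset.card_compl, hfour, hcard, Nat.cast_sub hn]
    norm_num
  rw [sumConn_eq_sum_neighbor_add G u, hN, hF, hsplit,
    Finset.sum_insert (by simp [hva, hvb]), Finset.sum_insert (by simp [hab]),
    Finset.sum_insert (by simp), Finset.sum_congr rfl dx, Finset.sum_const, nsmul_eq_mul, hrest,
    Finset.sum_pair (by simp [hab, hvb]), endDegreeSum_mk, endDegreeSum_mk, du', dv, da, db,
    minSumConn]
  have e1 : (n : ℝ) - 1 + (3 : ℕ) = n + 2 := by push_cast; ring
  have e2 : (n : ℝ) - 1 + (2 : ℕ) = n + 1 := by push_cast; ring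
  rw [e1, e2]
  norm_num
  ring

end Extremal

section Bound

open Classical

variable {V : Type*} [Fintype V] {G : SimpleGraph V} {n : ℕ}

lemma adj_iff_of_degree_eq (hcard : Fintype.card V = n) {u : V} (hu : G.degree u + 1 = n)
    (x y : V) : G.Adj x y ↔ x ≠ y ∧ (x = u ∨ y = u ∨ s(x, y) ∈ edgesAvoiding G u) := by
  have hN : insert u (G.neighborFinset u) = Finset.univ := by
    rw [← Finset.card_eq_iff_eq_univ, Finset.card_insert_of_notMem
      (G.notMem_neighborFinset_self u), SimpleGraph.card_neighborFinset_eq_degree, hcard, hu]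
  have hadj : ∀ x, x ≠ u → G.Adj u x := by
    intro x hx
    have := hN ▸ Finset.mem_univ x
    simpa [hx] using this
  simp only [edgesAvoiding, Finset.mem_filter, SimpleGraph.mem_edgeFinset,
    SimpleGraph.mem_edgeSet, Sym2.mem_iff]
  constructor
  · intro h
    have := h.ne
    tauto
  · rintro ⟨hne, rfl | rfl | h⟩
    · exact hadj y hne.symm
    · exact (hadj x hne).symm
    · exact h.1

lemma isStarPlusPath_or_endDegreeSum_le (hcard : Fintype.card V = n)
    (hedges : G.edgeFinset.card = n + 1) {u : V} (hu : G.degree u + 1 = n) :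
    IsStarPlusPath G ∨ ∀ e ∈ edgesAvoiding G u, endDegreeSum G e ≤ 4 := by
  have hk := card_edgesAvoiding_add_degree G u
  have huF : ∀ e ∈ edgesAvoiding G u, u ∉ e := fun e he => (Finset.mem_filter.1 he).2
  by_cases h : ∃ v a b : V, a ≠ b ∧ s(v, a) ∈ edgesAvoiding G u ∧ s(v, b) ∈ edgesAvoiding G u
  · left
    obtain ⟨v, a, b, hab, ha, hb⟩ := h
    have hF : ({s(v, a), s(v, b)} : Finset (Sym2 V)) = edgesAvoiding G u := by
      refine Finset.eq_of_subset_of_card_le (by simp [Finset.insert_subset_iff, ha, hb]) ?_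
      rw [Finset.card_pair fun h => hab (Sym2.congr_right.1 h)]
      omega
    have hua := huF _ ha
    have hub := huF _ hb
    have hva : v ≠ a := (show G.Adj v a by simpa using (Finset.mem_filter.1 ha).1).ne
    have hvb : v ≠ b := (show G.Adj v b by simpa using (Finset.mem_filter.1 hb).1).ne
    simp only [Sym2.mem_iff, not_or] at hua hub
    refine ⟨u, v, a, b, by simp [hua, hub, hva, hvb, hab], fun x y => ?_⟩
    rw [adj_iff_of_degree_eq hcard hu, ← hF]
    simp only [Finset.mem_insert, Finset.mem_singleton, Sym2.eq_iff]
    grind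
  · right
    push Not at h
    have hdeg : ∀ v, u ≠ v → G.degree v ≤ 2 := by
      intro v hv
      refine (degree_le_card_filter_edgesAvoiding G hv).trans (Nat.succ_le_succ ?_)
      refine Finset.card_le_one.2 fun e he f hf => ?_
      rw [Finset.mem_filter] at he hf
      obtain ⟨a, rfl⟩ := he.2
      obtain ⟨b, rfl⟩ := hf.2
      by_contra hne
      exact h v a b (fun hab => hne (by rw [hab])) he.1 hf.1
    intro e he
    have hue := huF e he
    induction e with
    | _ x y =>
      simp only [Sym2.mem_iff, not_or] at hue
      have h1 := hdeg x hue.1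
      have h2 := hdeg y hue.2
      rw [endDegreeSum_mk]
      omega

end Bound

section Main

open Classical

variable {V : Type*} [Fintype V] {G : SimpleGraph V} {n : ℕ}

lemma minSumConn_lt_sumConn_of_degree_lt (hn : 5 ≤ n) (hcard : Fintype.card V = n)
    (hdeg : ∀ v, 1 ≤ G.degree v) (hedges : G.edgeFinset.card = n + 1) {u : V}
    (hmax : ∀ v, G.degree v ≤ G.degree u) (hu : G.degree u + 2 ≤ n) :
    minSumConn n < sumConn G := by
  obtain ⟨d, hd⟩ : ∃ d, G.degree u = d := ⟨_, rfl⟩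
  rw [hd] at hu hmax
  have mean : ∀ k : ℕ, d ≤ k → ∀ p : ℝ, 0 < p →
      ((n : ℝ) + 2) * k + 2 * n + 2 ≤ p * (n + 1) → ((n : ℝ) + 1) / √p ≤ sumConn G :=
    fun k hk p hp h => div_sqrt_le_sumConn hcard hdeg hedges (fun v => (hmax v).trans hk) hp h
  have star : ∀ p : ℝ, 0 < p → (d : ℝ) ^ 2 + n + 3 ≤ p * d →
      d / √p + ((n : ℝ) + 1 - d) / √((n : ℝ) + 4 - d) ≤ sumConn G :=
    fun p hp h => div_sqrt_add_div_sqrt_le_sumConn hcard hdeg hedges hd hp h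
  rcases Nat.lt_or_ge n 10 with hn10 | hn10
  · interval_cases n
    · have h0 := minSumConn_five_lt
      have h1 := mean 3 (by omega) (11/2) (by norm_num) (by norm_num)
      have h2 := lt_one_div_sqrt (x := 11/2) (r := 0.42640) (by norm_num) (by norm_num)
      rw [div_sqrt_eq_mul] at h1
      norm_num at h0 h1 h2
      linarith
    · have h0 := minSumConn_six_lt
      obtain hdk | rfl : d ≤ 3 ∨ d = 4 := by omega
      · have h1 := mean 3 (by omega) (38/7) (by norm_num) (by norm_num)
        have h2 := lt_one_div_sqrt (x := 38/7) (r := 0.42919) (by norm_num) (by norm_num)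
        rw [div_sqrt_eq_mul] at h1
        norm_num at h0 h1 h2
        linarith
      · have h1 := star (25/4) (by norm_num) (by norm_num)
        have h2 := lt_one_div_sqrt (x := 25/4) (r := 0.39999) (by norm_num) (by norm_num)
        have h3 := lt_one_div_sqrt (x := 6) (r := 0.40824) (by norm_num) (by norm_num)
        rw [div_sqrt_eq_mul, div_sqrt_eq_mul (_ - _)] at h1
        norm_num at h0 h1 h2 h3
        linarith
    · have h0 := minSumConn_seven_lt
      obtain hdk | rfl : d ≤ 4 ∨ d = 5 := by omega
      · have h1 := mean 4 (by omega) (13/2) (by norm_num) (by norm_num)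
        have h2 := lt_one_div_sqrt (x := 13/2) (r := 0.39223) (by norm_num) (by norm_num)
        rw [div_sqrt_eq_mul] at h1
        norm_num at h0 h1 h2
        linarith
      · have h1 := star (7) (by norm_num) (by norm_num)
        have h2 := lt_one_div_sqrt (x := 7) (r := 0.37796) (by norm_num) (by norm_num)
        have h3 := lt_one_div_sqrt (x := 6) (r := 0.40824) (by norm_num) (by norm_num)
        rw [div_sqrt_eq_mul, div_sqrt_eq_mul (_ - _)] at h1
        norm_num at h0 h1 h2 h3
        linarith
    · have h0 := minSumConn_eight_lt
      obtain hdk | rfl | rfl : d ≤ 4 ∨ d = 5 ∨ d = 6 := by omega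
      · have h1 := mean 4 (by omega) (58/9) (by norm_num) (by norm_num)
        have h2 := lt_one_div_sqrt (x := 58/9) (r := 0.39391) (by norm_num) (by norm_num)
        rw [div_sqrt_eq_mul] at h1
        norm_num at h0 h1 h2
        linarith
      · have h1 := star (36/5) (by norm_num) (by norm_num)
        have h2 := lt_one_div_sqrt (x := 36/5) (r := 0.37267) (by norm_num) (by norm_num)
        have h3 := lt_one_div_sqrt (x := 7) (r := 0.37796) (by norm_num) (by norm_num)
        rw [div_sqrt_eq_mul, div_sqrt_eq_mul (_ - _)] at h1
        norm_num at h0 h1 h2 h3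
        linarith
      · have h1 := star (47/6) (by norm_num) (by norm_num)
        have h2 := lt_one_div_sqrt (x := 47/6) (r := 0.35729) (by norm_num) (by norm_num)
        have h3 := lt_one_div_sqrt (x := 6) (r := 0.40824) (by norm_num) (by norm_num)
        rw [div_sqrt_eq_mul, div_sqrt_eq_mul (_ - _)] at h1
        norm_num at h0 h1 h2 h3
        linarith
    · have h0 := minSumConn_nine_lt
      obtain hdk | rfl | rfl : d ≤ 5 ∨ d = 6 ∨ d = 7 := by omega
      · have h1 := mean 5 (by omega) (15/2) (by norm_num) (by norm_num)
        have h2 := lt_one_div_sqrt (x := 15/2) (r := 0.36514) (by norm_num) (by norm_num)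
        rw [div_sqrt_eq_mul] at h1
        norm_num at h0 h1 h2
        linarith
      · have h1 := star (8) (by norm_num) (by norm_num)
        have h2 := lt_one_div_sqrt (x := 8) (r := 0.35355) (by norm_num) (by norm_num)
        have h3 := lt_one_div_sqrt (x := 7) (r := 0.37796) (by norm_num) (by norm_num)
        rw [div_sqrt_eq_mul, div_sqrt_eq_mul (_ - _)] at h1
        norm_num at h0 h1 h2 h3
        linarith
      · have h1 := star (61/7) (by norm_num) (by norm_num)
        have h2 := lt_one_div_sqrt (x := 61/7) (r := 0.33875) (by norm_num) (by norm_num)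
        have h3 := lt_one_div_sqrt (x := 6) (r := 0.40824) (by norm_num) (by norm_num)
        rw [div_sqrt_eq_mul, div_sqrt_eq_mul (_ - _)] at h1
        norm_num at h0 h1 h2 h3
        linarith
  · have hn' : (10 : ℝ) ≤ n := by exact_mod_cast hn10
    rcases Nat.lt_or_ge (2 * d) (n + 3) with h | h
    · refine (minSumConn_lt_of_mean hn10).trans_le (mean d le_rfl _ (by positivity) ?_)
      have h' : 2 * (d : ℝ) ≤ n + 2 := by exact_mod_cast Nat.lt_succ_iff.1 h
      nlinarith
    · refine (minSumConn_lt_of_star hn10 hu h).trans_le (star _ (by positivity) ?_)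
      have h' : (n : ℝ) + 3 ≤ 2 * d := by exact_mod_cast h
      linarith

lemma minSumConn_lt_sumConn_of_endDegreeSum_le (hn : 5 ≤ n) (hcard : Fintype.card V = n)
    (hdeg : ∀ v, 1 ≤ G.degree v) (hedges : G.edgeFinset.card = n + 1) {u : V}
    (hu : G.degree u + 1 = n) (h : ∀ e ∈ edgesAvoiding G u, endDegreeSum G e ≤ 4) :
    minSumConn n < sumConn G := by
  have hn' : (5 : ℝ) ≤ n := by exact_mod_cast hn
  have hd : (G.degree u : ℝ) = n - 1 := by
    rw [eq_sub_iff_add_eq]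
    exact_mod_cast hu
  have hn1 : (0 : ℝ) < n - 1 := by linarith
  have hstar := degree_div_sqrt_add_le_sumConn hcard hdeg hedges u
    (p := (n : ℝ) + 4 / ((n : ℝ) - 1)) (by positivity) (by
      rw [hd, add_mul, div_mul_cancel₀ _ hn1.ne']
      linarith)
  have hF : ((edgesAvoiding G u).card : ℝ) = 2 := by
    have := card_edgesAvoiding_add_degree G u
    exact_mod_cast (by omega : (edgesAvoiding G u).card = 2)
  have hsum : ∀ e ∈ edgesAvoiding G u, 1 / √(4 : ℝ) ≤ 1 / √(endDegreeSum G e : ℝ) := by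
    intro e he
    have hpos := endDegreeSum_pos_of_mem_edgeFinset G (Finset.mem_filter.1 he).1
    exact one_div_le_one_div_of_le (Real.sqrt_pos.2 (by exact_mod_cast hpos))
      (Real.sqrt_le_sqrt (by exact_mod_cast h e he))
  have hsum' := Finset.sum_le_sum hsum
  rw [Finset.sum_const, nsmul_eq_mul, hF, mul_one_div] at hsum'
  rw [hd] at hstar
  refine lt_of_lt_of_le ?_ ((add_le_add le_rfl hsum').trans hstar)
  rcases Nat.lt_or_ge n 8 with hn8 | hn8
  · have h4 := lt_one_div_sqrt (x := 4) (r := 0.4999) (by norm_num) (by norm_num)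
    rw [div_sqrt_eq_mul _ (_ + _), div_sqrt_eq_mul 2 4]
    interval_cases n
    · have h0 := minSumConn_five_lt
      have h1 := lt_one_div_sqrt (x := 6) (r := 0.408) (by norm_num) (by norm_num)
      norm_num at h0 h1 h4 ⊢
      linarith
    · have h0 := minSumConn_six_lt
      have h1 := lt_one_div_sqrt (x := 34 / 5) (r := 0.383) (by norm_num) (by norm_num)
      norm_num at h0 h1 h4 ⊢
      linarith
    · have h0 := minSumConn_seven_lt
      have h1 := lt_one_div_sqrt (x := 23 / 3) (r := 0.361) (by norm_num) (by norm_num)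
      norm_num at h0 h1 h4 ⊢
      linarith
  · exact minSumConn_lt_of_disjoint hn8

lemma minSumConn_lt_sumConn_or_isStarPlusPath (hn : 5 ≤ n) (hcard : Fintype.card V = n)
    (hconn : G.Connected) (hedges : G.edgeFinset.card = n + 1) :
    minSumConn n < sumConn G ∨ IsStarPlusPath G := by
  have : Nontrivial V := Fintype.one_lt_card_iff_nontrivial.1 (by omega)
  have hdeg : ∀ v, 1 ≤ G.degree v := fun v => hconn.preconnected.degree_pos_of_nontrivial v
  obtain ⟨u, hu⟩ := G.exists_maximal_degree_vertex
  have hmax : ∀ v, G.degree v ≤ G.degree u := fun v => hu ▸ G.degree_le_maxDegree v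
  have hlt := G.degree_lt_card_verts u
  rcases Nat.lt_or_ge (G.degree u + 1) n with h | h
  · exact Or.inl (minSumConn_lt_sumConn_of_degree_lt hn hcard hdeg hedges hmax h)
  · have hu' : G.degree u + 1 = n := by omega
    rcases isStarPlusPath_or_endDegreeSum_le hcard hedges hu' with h | h
    · exact Or.inr h
    · exact Or.inl (minSumConn_lt_sumConn_of_endDegreeSum_le hn hcard hdeg hedges hu' h)

end Main

/-- Let `n ≥ 5` and let `G` be a bicyclic graph with `n` vertices. Then
`χ(G) ≥ 1/√(n+2) + (n−4)/√n + 2/√(n+1) + 2/√5`, with equality if and only if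
`G ≅ B_n(n−1, 3)`. -/
theorem stmt_10 {V : Type*} [Fintype V] (G : SimpleGraph V) (n : ℕ) (hn : 5 ≤ n)
    (hcard : Fintype.card V = n) (hconn : G.Connected)
    (hedges : G.edgeSet.ncard = n + 1) :
    sumConn G ≥ 1 / Real.sqrt ((n : ℝ) + 2) + ((n : ℝ) - 4) / Real.sqrt (n : ℝ) +
        2 / Real.sqrt ((n : ℝ) + 1) + 2 / Real.sqrt 5 ∧
    (sumConn G = 1 / Real.sqrt ((n : ℝ) + 2) + ((n : ℝ) - 4) / Real.sqrt (n : ℝ) +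
        2 / Real.sqrt ((n : ℝ) + 1) + 2 / Real.sqrt 5 ↔
      Nonempty (G ≃g BabGraph (n - 1) 3)) := by
  classical
  have hedges' : G.edgeFinset.card = n + 1 := by
    rw [← hedges, Set.ncard_eq_toFinset_card']
    rfl
  change sumConn G ≥ minSumConn n ∧ (sumConn G = minSumConn n ↔ _)
  have hB := isStarPlusPath_BabGraph (n - 1)
  have hBcard : Fintype.card (BabVert (n - 1) 3) = n := by
    change Fintype.card (Fin 4 ⊕ Fin (n - 1 - 3) ⊕ Fin (3 - 3)) = n
    simp
    omega
  have hcase := minSumConn_lt_sumConn_or_isStarPlusPath hn hcard hconn (by convert hedges')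
  refine ⟨?_, fun h => ?_, fun ⟨φ⟩ => (hB.of_iso φ.symm).sumConn_eq hcard⟩
  · rcases hcase with h | h
    · exact h.le
    · exact (h.sumConn_eq hcard).ge
  · rcases hcase with h' | h'
    · exact absurd h h'.ne'
    · exact h'.nonempty_iso hB (hcard.trans hBcard.symm)
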